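/- Suppose n ≥ 5 is minimal with the property that the alternating group A_n has property (I_p) with respect to some subgroup H and some prime p ≤ n, where the triple (A_n, H, p) is not among the cases of the classification table for alternating groups. Then any such H is a transitive subgroup of the symmetric group on the n points; in particular p does not divide n. -/

import Mathlib

/-- A module is indecomposable if it is nonzero and admits no nontrivial direct sum
decomposition. -/
def IsIndecomposableModule (R M : Type*) [Ring R] [AddCommMonoid M] [Module R M] : Prop :=
  Nontrivial M ∧ ∀ N N' : Submodule R M, IsCompl N N' → N = ⊥ ∨ N' = ⊥

/-- The permutation module `k[G/H]`, as a module over the group algebra `k[G]`. -/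
abbrev PermMod (k : Type*) [Field k] {G : Type*} [Group G] (H : Subgroup G) :=
  (Representation.ofMulAction k G (G ⧸ H)).asModule

/-- A finite group `G` has property `(I_p)` with respect to a subgroup `H` if `H` is a
`p'`-subgroup and the permutation module `k[G/H]` is indecomposable (equivalently, it is the
projective cover of the trivial `k[G]`-module). -/
def HasIp (k : Type*) [Field k] {G : Type*} [Group G] (p : ℕ) (H : Subgroup G) : Prop :=
  ¬ (p ∣ Nat.card H) ∧ IsIndecomposableModule (MonoidAlgebra k G) (PermMod k H)

/-- The projective special linear group `PSL_3(2)`. -/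
abbrev PSL3F2 :=
  Matrix.SpecialLinearGroup (Fin 3) (ZMod 2) ⧸
    Subgroup.center (Matrix.SpecialLinearGroup (Fin 3) (ZMod 2))

/-- The classification table of triples `(A_n, H, p)` with `A_n` having property `(I_p)` with
respect to `H`. -/
def AltTable (n p : ℕ) (H : Subgroup ↥(alternatingGroup (Fin n))) : Prop :=
  -- (i) `n = p` prime, `H ≅ A_{n-1}` a point stabilizer, of index `n`
  (n = p ∧ (∃ a : Fin n, H = MulAction.stabilizer ↥(alternatingGroup (Fin n)) a) ∧
    Nonempty (↥H ≃* ↥(alternatingGroup (Fin (n - 1)))) ∧ H.index = n) ∨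
  -- (ii) `n = 5`, `p = 2`, `H ≅ C_5`, of index `12`
  (n = 5 ∧ p = 2 ∧ IsCyclic ↥H ∧ Nat.card H = 5 ∧ H.index = 12) ∨
  -- (iii) `n = 5`, `p = 3`, `H ≅ D_5` dihedral of order `10`, of index `6`
  (n = 5 ∧ p = 3 ∧ Nonempty (↥H ≃* DihedralGroup 5) ∧ H.index = 6) ∨
  -- (iv) `n = 6`, `p = 2`, `H ≅ C_3 × C_3` elementary abelian of order `9`, of index `40`
  (n = 6 ∧ p = 2 ∧
    Nonempty (↥H ≃* (Multiplicative (ZMod 3) × Multiplicative (ZMod 3))) ∧ H.index = 40) ∨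
  -- (v) `n = 6`, `p = 5`, `H ≅ 3^2:4` of order `36`, of index `10`
  (n = 6 ∧ p = 5 ∧ Nat.card H = 36 ∧
    (∃ N C : Subgroup ↥H, N.Normal ∧
      Nonempty (↥N ≃* (Multiplicative (ZMod 3) × Multiplicative (ZMod 3))) ∧
      IsCyclic ↥C ∧ Nat.card C = 4 ∧ N ⊓ C = ⊥ ∧ N ⊔ C = ⊤) ∧ H.index = 10) ∨
  -- (vi) `n = 7`, `p = 5`, `H ≅ PSL_3(2)` of order `168`, of index `15`
  (n = 7 ∧ p = 5 ∧ Nat.card H = 168 ∧ Nonempty (↥H ≃* PSL3F2) ∧ H.index = 15) ∨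
  -- (vii) `n = 8`, `p = 5`, `H ≅ 2^3:PSL_3(2)` of order `1344`, of index `15`
  (n = 8 ∧ p = 5 ∧ Nat.card H = 1344 ∧
    (∃ N C : Subgroup ↥H, N.Normal ∧ Nat.card N = 8 ∧ (∀ x ∈ N, x * x = 1) ∧
      Nonempty (↥C ≃* PSL3F2) ∧ N ⊓ C = ⊥ ∧ N ⊔ C = ⊤) ∧ H.index = 15)

set_option linter.style.haveILetI false
set_option linter.unusedSectionVars false

namespace IpAux

open MonoidAlgebra

section Algebra

variable {k : Type*} [Field k] {G : Type*} [Group G] [Finite G]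

/-- The augmentation of the group algebra. -/
noncomputable def aug (k : Type*) [Field k] (G : Type*) [Group G] : MonoidAlgebra k G →ₐ[k] k :=
  MonoidAlgebra.lift k k G 1

theorem aug_single (g : G) (c : k) : aug k G (single g c) = c := by
  simp [aug, MonoidAlgebra.lift_single]

open scoped Classical in
/-- The averaging idempotent of a subgroup. -/
noncomputable def avg (k : Type*) [Field k] {G : Type*} [Group G] [Finite G] (H : Subgroup G) :
    MonoidAlgebra k G :=
  letI := Fintype.ofFinite H
  ∑ h : H, single (h : G) ((Nat.card H : k)⁻¹)

theorem mul_avg_of (H : Subgroup G) {h : G} (hh : h ∈ H) : single h (1 : k) * avg k H = avg k H := by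
  classical
  letI := Fintype.ofFinite H
  unfold avg
  rw [Finset.mul_sum]
  refine Fintype.sum_bijective (fun x : H => (⟨h, hh⟩ : H) * x) (Group.mulLeft_bijective _) _ _ ?_
  intro x
  simp [single_mul_single]

theorem avg_mul_of (H : Subgroup G) {h : G} (hh : h ∈ H) : avg k H * single h (1 : k) = avg k H := by
  classical
  letI := Fintype.ofFinite H
  unfold avg
  rw [Finset.sum_mul]
  refine Fintype.sum_bijective (fun x : H => x * (⟨h, hh⟩ : H)) (Group.mulRight_bijective _) _ _ ?_
  intro x
  simp [single_mul_single]

/-- If all singles of `H` act by fixing `b`, so does the average. -/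
theorem avg_map_mul (H : Subgroup G) (hc : (Nat.card H : k) ≠ 0) {Q : Type*} [Group Q]
    (φ : G →* Q) (b : MonoidAlgebra k Q)
    (hb : ∀ h ∈ H, single (φ h) (1 : k) * b = b) :
    mapDomainAlgHom k k φ (avg k H) * b = b := by
  classical
  letI := Fintype.ofFinite H
  unfold avg
  rw [map_sum, Finset.sum_mul]
  have : ∀ h : H, mapDomainAlgHom k k φ (single (h : G) ((Nat.card H : k)⁻¹)) * b
      = (Nat.card H : k)⁻¹ • b := by
    intro h
    have h1 : mapDomainAlgHom k k φ (single (h : G) ((Nat.card H : k)⁻¹))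
      = (Nat.card H : k)⁻¹ • single (φ h) (1 : k) := by simp
    rw [h1, smul_mul_assoc, hb h h.2]
  rw [Finset.sum_congr rfl (fun h _ => this h), Finset.sum_const, ← Nat.cast_smul_eq_nsmul k, smul_smul,
    Finset.card_univ, ← Nat.card_eq_fintype_card, mul_inv_cancel₀ hc, one_smul]

theorem map_avg_mul (H : Subgroup G) (hc : (Nat.card H : k) ≠ 0) {Q : Type*} [Group Q]
    (φ : G →* Q) (b : MonoidAlgebra k Q)
    (hb : ∀ h ∈ H, b * single (φ h) (1 : k) = b) :
    b * mapDomainAlgHom k k φ (avg k H) = b := by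
  classical
  letI := Fintype.ofFinite H
  unfold avg
  rw [map_sum, Finset.mul_sum]
  have : ∀ h : H, b * mapDomainAlgHom k k φ (single (h : G) ((Nat.card H : k)⁻¹))
      = (Nat.card H : k)⁻¹ • b := by
    intro h
    have h1 : mapDomainAlgHom k k φ (single (h : G) ((Nat.card H : k)⁻¹))
      = (Nat.card H : k)⁻¹ • single (φ h) (1 : k) := by simp
    rw [h1, mul_smul_comm, hb h h.2]
  rw [Finset.sum_congr rfl (fun h _ => this h), Finset.sum_const, ← Nat.cast_smul_eq_nsmul k, smul_smul,
    Finset.card_univ, ← Nat.card_eq_fintype_card, mul_inv_cancel₀ hc, one_smul]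

theorem aug_avg (H : Subgroup G) (hc : (Nat.card H : k) ≠ 0) : aug k G (avg k H) = 1 := by
  classical
  letI := Fintype.ofFinite H
  unfold avg
  rw [map_sum, Finset.sum_congr rfl (fun h _ => aug_single _ _), Finset.sum_const,
    ← Nat.cast_smul_eq_nsmul k, Finset.card_univ, ← Nat.card_eq_fintype_card, smul_eq_mul,
    mul_inv_cancel₀ hc]

/-- `avg` acts as the identity on a vector fixed by `H` (in any representation). -/
theorem avg_lift_fix (H : Subgroup G) (hc : (Nat.card H : k) ≠ 0) {V : Type*} [AddCommGroup V]
    [Module k V] (ρ : G →* Module.End k V) (v : V) (hv : ∀ h ∈ H, ρ h v = v) :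
    MonoidAlgebra.lift k _ G ρ (avg k H) v = v := by
  classical
  letI := Fintype.ofFinite H
  unfold avg
  rw [map_sum, LinearMap.sum_apply]
  have : ∀ h : H, MonoidAlgebra.lift k _ G ρ (single (h : G) ((Nat.card H : k)⁻¹)) v
      = (Nat.card H : k)⁻¹ • v := by
    intro h
    rw [MonoidAlgebra.lift_single, LinearMap.smul_apply, hv h h.2]
  rw [Finset.sum_congr rfl (fun h _ => this h), Finset.sum_const, ← Nat.cast_smul_eq_nsmul k, smul_smul,
    Finset.card_univ, ← Nat.card_eq_fintype_card, mul_inv_cancel₀ hc, one_smul]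

/-- Ring-theoretic form of property `(I_p)`. -/
def LP (k : Type*) [Field k] {G : Type*} [Group G] [Finite G] (H : Subgroup G) : Prop :=
  (Nat.card H : k) ≠ 0 ∧
    ∀ x : MonoidAlgebra k G, aug k G x ≠ 0 → ∃ z, z * avg k H * x * avg k H = avg k H

theorem map_avg (H : Subgroup G) (hc : (Nat.card H : k) ≠ 0) {Q : Type*} [Group Q] [Finite Q]
    (φ : G →* Q) (hc' : (Nat.card (H.map φ) : k) ≠ 0) :
    mapDomainAlgHom k k φ (avg k H) = avg k (H.map φ) := by
  have h1 : avg k (H.map φ) * mapDomainAlgHom k k φ (avg k H) = avg k (H.map φ) := by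
    apply map_avg_mul H hc
    intro h hh
    exact avg_mul_of _ (Subgroup.mem_map_of_mem φ hh)
  have h2 : mapDomainAlgHom k k (MonoidHom.id Q) (avg k (H.map φ)) * mapDomainAlgHom k k φ (avg k H)
      = mapDomainAlgHom k k φ (avg k H) := by
    apply avg_map_mul _ hc'
    rintro _ ⟨h, hh, rfl⟩
    have : single (MonoidHom.id Q (φ h)) (1 : k) = mapDomainAlgHom k k φ (single h 1) := by simp
    rw [this, ← map_mul, mul_avg_of H hh]
  rw [mapDomainAlgHom_id] at h2
  rw [← h2, AlgHom.id_apply, h1]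

theorem card_map_ne_zero (H : Subgroup G) (hc : (Nat.card H : k) ≠ 0) {Q : Type*} [Group Q]
    (φ : G →* Q) : (Nat.card (H.map φ) : k) ≠ 0 := by
  obtain ⟨c, hc'⟩ := Subgroup.card_map_dvd H φ
  intro h
  apply hc
  rw [hc', Nat.cast_mul, h, zero_mul]

theorem aug_map {Q : Type*} [Group Q] (φ : G →* Q) (x : MonoidAlgebra k G) :
    aug k Q (mapDomainAlgHom k k φ x) = aug k G x := by
  have : (aug k Q).comp (mapDomainAlgHom k k φ) = aug k G := by
    ext g
    simp [aug]
  rw [← this]; rfl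

theorem LP.map_surj {H : Subgroup G} (h : LP k H) {Q : Type*} [Group Q] [Finite Q]
    (φ : G →* Q) (hφ : Function.Surjective φ) : LP k (H.map φ) := by
  have hc' := card_map_ne_zero H h.1 φ
  refine ⟨hc', fun x hx => ?_⟩
  obtain ⟨y, rfl⟩ : ∃ y, mapDomainAlgHom k k φ y = x := by
    have : Function.Surjective (mapDomainAlgHom k k φ) := by
      intro x
      induction x using MonoidAlgebra.induction_on with
      | of g =>
        obtain ⟨g, rfl⟩ := hφ g
        exact ⟨single g 1, by simp⟩
      | add x y hx hy =>
        obtain ⟨x, rfl⟩ := hx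
        obtain ⟨y, rfl⟩ := hy
        exact ⟨x + y, map_add _ _ _⟩
      | smul c x hx =>
        obtain ⟨x, rfl⟩ := hx
        exact ⟨c • x, map_smul _ _ _⟩
    exact this x
  rw [aug_map] at hx
  obtain ⟨z, hz⟩ := h.2 y hx
  refine ⟨mapDomainAlgHom k k φ z, ?_⟩
  rw [← map_avg H h.1 φ hc', ← map_mul, ← map_mul, ← map_mul, hz]

theorem comap_mul {N : Type*} [Group N] (j : N →* G) (hj : Function.Injective j)
    (z : MonoidAlgebra k G) (y : MonoidAlgebra k N) :
    comapDomain j hj (z * mapDomainAlgHom k k j y) = comapDomain j hj z * y := by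
  induction y using MonoidAlgebra.induction_on with
  | of n =>
    ext m
    have : mapDomainAlgHom k k j (of k N n) = single (j n) 1 := by simp
    rw [this]
    simp [of_apply]
  | add x y hx hy => rw [map_add, mul_add, comapDomain_add, hx, hy, mul_add]
  | smul c x hx =>
    rw [map_smul, mul_smul_comm, mul_smul_comm, ← hx]
    ext m
    simp

theorem LP.comap_inj {N : Type*} [Group N] [Finite N] (j : N →* G) (hj : Function.Injective j)
    (H : Subgroup N) (h : LP k (H.map j)) : LP k H := by
  have hcard : Nat.card (H.map j) = Nat.card H :=
    Nat.card_congr (H.equivMapOfInjective j hj).toEquiv.symm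
  have hc : (Nat.card H : k) ≠ 0 := by rw [← hcard]; exact h.1
  refine ⟨hc, fun x hx => ?_⟩
  obtain ⟨z, hz⟩ := h.2 (mapDomainAlgHom k k j x) (by rwa [aug_map])
  refine ⟨comapDomain j hj z, ?_⟩
  rw [← map_avg H hc j h.1] at hz
  rw [mul_assoc z, mul_assoc z, ← map_mul, ← map_mul] at hz
  have h2 := congrArg (comapDomain j hj) hz
  rw [comap_mul] at h2
  have h3 := comap_mul (k := k) j hj 1 (avg k H)
  have h4 : comapDomain j hj (1 : MonoidAlgebra k G) = 1 := by
    have h1 : (1 : MonoidAlgebra k G) = single (j 1) 1 := by rw [map_one, MonoidAlgebra.one_def]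
    rw [h1, MonoidAlgebra.one_def]
    ext m
    classical
    simp only [coeff_comapDomain, Finsupp.comapDomain_apply, coeff_single, Finsupp.single_apply,
      hj.eq_iff]
  rw [one_mul, h4, one_mul] at h3
  rw [h3] at h2
  rw [mul_assoc, mul_assoc, ← mul_assoc (avg k H) x, h2]

/-- Main test: an `H`-invariant function which is an eigenvector of a sum of group elements with
an eigenvalue different from the number of terms must vanish. -/
theorem LP.test {H : Subgroup G} (h : LP k H) {X : Type*} [MulAction G X] (F : X → k)
    (hF : ∀ g ∈ H, ∀ x, F (g • x) = F x) {ι : Type*} [Fintype ι] (g : ι → G) (c : k)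
    (hg : ∀ x, ∑ i, F (g i • x) = c * F x) (hne : (Fintype.card ι : k) ≠ c) : F = 0 := by
  classical
  let ρ : G →* Module.End k (X → k) :=
    { toFun := fun g => LinearMap.funLeft k k (fun x => g⁻¹ • x)
      map_one' := by ext; simp [LinearMap.funLeft_apply]
      map_mul' := by
        intro a b
        refine LinearMap.ext fun f => funext fun x => ?_
        simp [LinearMap.funLeft_apply, mul_smul] }
  have hρ : ∀ g f x, ρ g f x = f (g⁻¹ • x) := fun _ _ _ => rfl
  let Φ := MonoidAlgebra.lift k _ G ρ
  let x : MonoidAlgebra k G := (∑ i, single (g i)⁻¹ (1 : k)) - single 1 c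
  have hx : aug k G x ≠ 0 := by
    simp only [x, map_sub, map_sum, aug_single]
    simpa [sub_eq_zero] using hne
  obtain ⟨z, hz⟩ := h.2 x hx
  have he : Φ (avg k H) F = F := by
    apply avg_lift_fix H h.1
    intro g hg
    ext y
    rw [hρ, hF _ (H.inv_mem hg)]
  have hxF : Φ x F = 0 := by
    ext y
    simp only [x, Φ, map_sub, map_sum, MonoidAlgebra.lift_single, LinearMap.sub_apply,
      LinearMap.sum_apply, one_smul, map_one, LinearMap.smul_apply, Pi.sub_apply, Finset.sum_apply,
      hρ, inv_inv, hg]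
    simp
  rw [← he, ← hz, map_mul, map_mul, Module.End.mul_apply, Module.End.mul_apply, he, hxF, map_zero]

/-- `H` has maximal order among the `p'`-subgroups. -/
theorem LP.card_le {H : Subgroup G} (h : LP k H) (K : Subgroup G) (hK : (Nat.card K : k) ≠ 0) :
    Nat.card K ≤ Nat.card H := by
  classical
  letI := Fintype.ofFinite G
  letI := Fintype.ofFinite K
  letI := Fintype.ofFinite (G ⧸ H)
  letI := Fintype.ofFinite (G ⧸ K)
  let L : (G ⧸ H → k) →ₗ[k] (G ⧸ K → k) :=
    { toFun := fun f q => ∑ κ : K, f (QuotientGroup.mk (q.out * (κ : G)))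
      map_add' := by intro a b; ext q; simp [Finset.sum_add_distrib]
      map_smul' := by intro a b; ext q; simp [Finset.mul_sum] }
  have hL : Function.Injective L := by
    rw [← LinearMap.ker_eq_bot, LinearMap.ker_eq_bot']
    intro f hf
    have := h.test (X := G) (fun y => f (QuotientGroup.mk y⁻¹)) (by
      intro g hg x
      congr 1
      rw [smul_eq_mul, mul_inv_rev, QuotientGroup.mk_mul_of_mem _ (H.inv_mem hg)])
      (fun κ : K => (κ : G)) 0 (by
        intro y
        rw [zero_mul]
        have h1 := congrFun hf (QuotientGroup.mk y⁻¹)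
        change ∑ κ : K, f (QuotientGroup.mk ((QuotientGroup.mk y⁻¹ : G ⧸ K).out * (κ : G))) = 0 at h1
        obtain ⟨κ0, hκ0⟩ := QuotientGroup.mk_out_eq_mul K y⁻¹
        rw [hκ0] at h1
        rw [← h1]
        refine Fintype.sum_bijective (fun κ => κ0⁻¹ * κ⁻¹)
          ((Group.mulLeft_bijective _).comp (Equiv.inv K).bijective) _ _ ?_
        intro κ
        simp [mul_assoc]) (by rwa [← Nat.card_eq_fintype_card])
    ext q
    obtain ⟨y, rfl⟩ := QuotientGroup.mk_surjective q
    have := congrFun this y⁻¹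
    simpa using this
  have h1 := LinearMap.finrank_le_finrank_of_injective hL
  rw [Module.finrank_pi, Module.finrank_pi, ← Nat.card_eq_fintype_card, ← Nat.card_eq_fintype_card]
    at h1
  have e1 := H.card_mul_index
  have e2 := K.card_mul_index
  change H.index ≤ K.index at h1
  by_contra hlt
  push Not at hlt
  have : Nat.card H * H.index < Nat.card K * K.index :=
    Nat.mul_lt_mul_of_lt_of_le hlt h1 (Nat.pos_of_ne_zero K.index_ne_zero_of_finite)
  omega

end Algebra
end IpAux

namespace IpAux
open MonoidAlgebra

section Modules

variable {k : Type*} [Field k] {G : Type*} [Group G] [Finite G]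

/-- The base point of the permutation module. -/
noncomputable def v0 (k : Type*) [Field k] {G : Type*} [Group G] (H : Subgroup G) : PermMod k H :=
  (Representation.ofMulAction k G (G ⧸ H)).asModuleEquiv.symm
    (single (QuotientGroup.mk (1 : G) : G ⧸ H) (1 : k))

/-- The embedding of the permutation module in the group algebra. -/
noncomputable def theta (k : Type*) [Field k] {G : Type*} [Group G] [Finite G] (H : Subgroup G) :
    PermMod k H →ₗ[k] MonoidAlgebra k G :=
  (Finsupp.lsum k (fun q : G ⧸ H =>
      LinearMap.toSpanSingleton k (MonoidAlgebra k G) (single q.out (1 : k) * avg k H))) ∘ₗ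
    (coeffLinearEquiv k).toLinearMap ∘ₗ
      (Representation.ofMulAction k G (G ⧸ H)).asModuleEquiv.toLinearMap

theorem single_smul_v0 (H : Subgroup G) (g : G) (c : k) :
    (single g c : MonoidAlgebra k G) • v0 k H =
      (Representation.ofMulAction k G (G ⧸ H)).asModuleEquiv.symm
        (single (QuotientGroup.mk g : G ⧸ H) c) := by
  rw [LinearEquiv.eq_symm_apply, Representation.asModuleEquiv_map_smul, v0,
    LinearEquiv.apply_symm_apply, Representation.asAlgebraHom_single, LinearMap.smul_apply,
    Representation.ofMulAction_single]
  simp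

theorem smul_v0_surj (H : Subgroup G) (m : PermMod k H) :
    ∃ a : MonoidAlgebra k G, a • v0 k H = m := by
  obtain ⟨f, rfl⟩ := (Representation.ofMulAction k G (G ⧸ H)).asModuleEquiv.symm.surjective m
  induction f using MonoidAlgebra.induction_linear with
  | zero => exact ⟨0, by simp⟩
  | add x y hx hy =>
    obtain ⟨a, ha⟩ := hx
    obtain ⟨b, hb⟩ := hy
    exact ⟨a + b, by rw [add_smul, ha, hb, map_add]⟩
  | single q c =>
    obtain ⟨g, rfl⟩ := QuotientGroup.mk_surjective q
    exact ⟨single g c, single_smul_v0 H g c⟩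

theorem theta_smul (H : Subgroup G) (a : MonoidAlgebra k G) :
    theta k H (a • v0 k H) = a * avg k H := by
  induction a using MonoidAlgebra.induction_linear with
  | zero => simp
  | add x y hx hy => rw [add_smul, map_add, hx, hy, add_mul]
  | single g c =>
    rw [single_smul_v0]
    obtain ⟨h, hh⟩ := QuotientGroup.mk_out_eq_mul H g
    have h1 : theta k H ((Representation.ofMulAction k G (G ⧸ H)).asModuleEquiv.symm
        (single (QuotientGroup.mk g : G ⧸ H) c)) =
        c • (single (QuotientGroup.mk g : G ⧸ H).out (1 : k) * avg k H) := by
      simp [theta]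
    have h2 : (single (g * (h : G)) (1 : k) : MonoidAlgebra k G) = single g 1 * single (h : G) 1 := by
      simp
    rw [h1, hh, h2, mul_assoc, mul_avg_of H h.2, ← smul_mul_assoc]
    simp

theorem avg_smul_v0 (H : Subgroup G) (hc : (Nat.card H : k) ≠ 0) :
    avg k H • v0 k H = v0 k H := by
  apply (Representation.ofMulAction k G (G ⧸ H)).asModuleEquiv.injective
  rw [Representation.asModuleEquiv_map_smul]
  apply avg_lift_fix H hc
  intro h hh
  rw [v0, LinearEquiv.apply_symm_apply, Representation.ofMulAction_single]
  congr 1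
  rw [MulAction.Quotient.smul_mk, smul_eq_mul, mul_one]
  exact (QuotientGroup.eq (s := H)).2 (by simpa using hh)

/-- Augmentation on the permutation module. -/
theorem aug_theta (H : Subgroup G) (hc : (Nat.card H : k) ≠ 0) (a : MonoidAlgebra k G) :
    aug k G (theta k H (a • v0 k H)) = aug k G a := by
  rw [theta_smul, map_mul, aug_avg H hc, mul_one]

theorem LP_of_HasIp {p : ℕ} [Fact p.Prime] [CharP k p] {H : Subgroup G} (h : HasIp k p H) :
    LP k H := by
  have hc : (Nat.card H : k) ≠ 0 := by
    rw [Ne, CharP.cast_eq_zero_iff k p]; exact h.1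
  refine ⟨hc, fun x hx => ?_⟩
  obtain ⟨-, -, hind⟩ := h
  let R := MonoidAlgebra k G
  let M := PermMod k H
  let w : M := (avg k H * x) • v0 k H
  let α : R →ₗ[R] M := LinearMap.toSpanSingleton R M (v0 k H)
  let β : R →ₗ[R] M := LinearMap.toSpanSingleton R M w
  have hα : Function.Surjective α := fun m => by
    obtain ⟨a, ha⟩ := smul_v0_surj H m
    exact ⟨a, ha⟩
  have hle : LinearMap.ker α ≤ LinearMap.ker β := by
    intro a ha
    have ha : a • v0 k H = 0 := ha
    have h1 : a * avg k H = 0 := by rw [← theta_smul, ha, map_zero]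
    change a • ((avg k H * x) • v0 k H) = 0
    rw [smul_smul, ← mul_assoc, h1, zero_mul, zero_smul]
  let φ : M →ₗ[R] M := (Submodule.liftQ _ β hle) ∘ₗ
    (LinearMap.quotKerEquivOfSurjective α hα).symm.toLinearMap
  have hφ : ∀ a : R, φ (a • v0 k H) = (a * (avg k H * x)) • v0 k H := by
    intro a
    have h1 : (LinearMap.quotKerEquivOfSurjective α hα).symm (a • v0 k H) = Submodule.Quotient.mk a := by
      rw [LinearEquiv.symm_apply_eq]
      rfl
    change (Submodule.liftQ _ β hle) ((LinearMap.quotKerEquivOfSurjective α hα).symm (a • v0 k H)) = _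
    rw [h1, mul_smul]
    rfl
  have hfinR : Module.Finite k R := Module.Finite.equiv (coeffLinearEquiv k).symm
  haveI : IsArtinianRing R := IsArtinianRing.of_finite k R
  haveI : IsNoetherianRing R := IsNoetherianRing.of_finite k R
  haveI : Module.Finite R M := Module.Finite.of_surjective α hα
  have hpow : ∀ n : ℕ, ∀ a : R, aug k G (theta k H ((φ ^ n) (a • v0 k H))) = aug k G a * aug k G x ^ n := by
    intro n
    induction n with
    | zero => intro a; rw [pow_zero, pow_zero, mul_one]; exact aug_theta H hc a
    | succ n ih =>
      intro a
      rw [pow_succ, Module.End.mul_apply, hφ, ih, map_mul, map_mul, aug_avg H hc]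
      ring
  obtain ⟨n, hn⟩ := (LinearMap.eventually_isCompl_ker_pow_range_pow φ).exists_forall_of_atTop
  have hcompl := hn (n + 1) (Nat.le_succ n)
  have hinj : Function.Injective φ := by
    rcases hind _ _ hcompl with h1 | h1
    · rw [LinearMap.ker_eq_bot] at h1
      intro u v huv
      apply h1
      rw [pow_succ, Module.End.mul_apply, Module.End.mul_apply, huv]
    · exfalso
      have h2 := hpow (n + 1) 1
      have h3 : (φ ^ (n + 1)) ((1 : R) • v0 k H) = 0 := by
        have : (φ ^ (n + 1)) ((1 : R) • v0 k H) ∈ LinearMap.range (φ ^ (n + 1)) := ⟨_, rfl⟩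
        rw [h1] at this
        exact this
      rw [h3, map_zero, map_zero, map_one, one_mul] at h2
      exact pow_ne_zero _ hx h2.symm
  obtain ⟨m, hm⟩ := IsArtinian.surjective_of_injective_endomorphism φ hinj (v0 k H)
  obtain ⟨z, rfl⟩ := smul_v0_surj H m
  rw [hφ] at hm
  refine ⟨z, ?_⟩
  have h5 := theta_smul H (z * (avg k H * x))
  have h6 := theta_smul (k := k) H 1
  rw [one_smul] at h6
  rw [hm, h6, one_mul] at h5
  rw [mul_assoc z]; exact h5.symm

theorem HasIp_of_LP {p : ℕ} [Fact p.Prime] [CharP k p] {H : Subgroup G} (h : LP k H) :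
    HasIp k p H := by
  obtain ⟨hc, hP⟩ := h
  refine ⟨by rwa [← CharP.cast_eq_zero_iff k p], ⟨⟨v0 k H, 0, fun h0 => ?_⟩, ?_⟩⟩
  · have h1 := aug_theta H hc 1
    rw [one_smul, h0, map_zero, map_zero, map_one] at h1
    exact zero_ne_one h1
  have key : ∀ N N' : Submodule (MonoidAlgebra k G) (PermMod k H), IsCompl N N' →
      ∀ u ∈ N, ∀ u' ∈ N', u + u' = v0 k H → aug k G (theta k H u) ≠ 0 → N' = ⊥ := by
    intro N N' hN u hu u' hu' hsum hne
    obtain ⟨x, rfl⟩ := smul_v0_surj H u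
    rw [aug_theta H hc] at hne
    obtain ⟨z, hz⟩ := hP x hne
    have h1 : avg k H • x • v0 k H + avg k H • u' = x • v0 k H + u' := by
      rw [← smul_add, hsum, avg_smul_v0 H hc]
    have h2 : avg k H • x • v0 k H - x • v0 k H = u' - avg k H • u' := by
      rw [sub_eq_sub_iff_add_eq_add, h1, add_comm]
    have h3 : avg k H • x • v0 k H - x • v0 k H ∈ N ⊓ N' := by
      refine ⟨N.sub_mem (N.smul_mem _ hu) hu, ?_⟩
      rw [h2]
      exact N'.sub_mem hu' (N'.smul_mem _ hu')
    rw [hN.inf_eq_bot, Submodule.mem_bot, sub_eq_zero] at h3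
    have h4 : z • x • v0 k H = v0 k H := by
      rw [← h3, ← avg_smul_v0 H hc, smul_smul, smul_smul, smul_smul, hz]
    have h5 : N = ⊤ := by
      rw [eq_top_iff]
      rintro m -
      obtain ⟨a, rfl⟩ := smul_v0_surj H m
      apply N.smul_mem
      rw [← h4]
      exact N.smul_mem _ hu
    have := hN.inf_eq_bot
    rwa [h5, top_inf_eq] at this
  intro N N' hN
  have hmem : v0 k H ∈ N ⊔ N' := by rw [hN.sup_eq_top]; trivial
  obtain ⟨u, hu, u', hu', hsum⟩ := Submodule.mem_sup.1 hmem
  by_cases h0 : aug k G (theta k H u) = 0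
  · left
    refine key N' N hN.symm u' hu' u hu (by rw [add_comm, hsum]) ?_
    have h1 := aug_theta H hc 1
    rw [one_smul, ← hsum, map_add, map_add, h0, zero_add, map_one] at h1
    rw [h1]
    exact one_ne_zero
  · right
    exact key N N' hN u hu u' hu' hsum h0

end Modules
end IpAux

namespace IpAux
open MonoidAlgebra Equiv

section Trans

/-- An even sharply transitive family. -/
theorem exists_sharp (n : ℕ) (hn : 3 ≤ n) : ∃ g : Fin n → alternatingGroup (Fin n),
    ∀ x : Fin n, Function.Bijective (fun i => g i • x) := by
  obtain ⟨m, rfl⟩ : ∃ m, n = m + 1 := ⟨n - 1, by omega⟩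
  have hrot : ∀ (j : ℕ) (x : Fin (m + 1)), (((finRotate (m + 1)) ^ j) x).val = (x.val + j) % (m + 1) := by
    intro j
    induction j with
    | zero => intro x; simp [Nat.mod_eq_of_lt x.2]
    | succ j ih =>
      intro x
      rw [pow_succ', Perm.mul_apply, finRotate_apply, Fin.val_add, ih, Fin.val_one', Nat.add_mod_mod, Nat.mod_add_mod, add_assoc]
  let z : Fin (m + 1) := ⟨0, by omega⟩
  let t : Fin (m + 1) := ⟨2, by omega⟩
  have hzt : z ≠ t := by simp [z, t, Fin.ext_iff]
  let s : Fin (m + 1) → Perm (Fin (m + 1)) := fun i => if Even (m * i.val) then 1 else swap z t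
  have hs : ∀ i x, (s i x).val % 2 = x.val % 2 := by
    intro i x
    simp only [s]
    split_ifs
    · rfl
    · rw [swap_apply_def]
      split_ifs with h1 h2
      · simp [h1, z, t]
      · simp [h2, z, t]
      · rfl
  have hsign : ∀ i : Fin (m + 1), finRotate (m + 1) ^ (i.val) * s i ∈ alternatingGroup (Fin (m + 1)) := by
    intro i
    rw [Perm.mem_alternatingGroup, map_mul, map_pow, sign_finRotate, ← pow_mul, Nat.add_sub_cancel]
    by_cases h : Even (m * i.val)
    · simp [s, h]
    · have h2 := Nat.not_even_iff_odd.1 h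
      simp only [s, if_neg h, Perm.sign_swap hzt]
      rw [h2.neg_one_pow]
      simp
  refine ⟨fun i => ⟨_, hsign i⟩, fun x => ?_⟩
  rw [← Finite.injective_iff_bijective]
  intro i j hij
  have hij : ((finRotate (m + 1) ^ (i.val)) (s i x)) = ((finRotate (m + 1) ^ (j.val)) (s j x)) := hij
  have h1 := congrArg Fin.val hij
  rw [hrot, hrot] at h1
  have key : s i x = s j x → i = j := by
    intro h
    rw [h] at h1
    have h3 : i.val ≡ j.val [MOD m + 1] := Nat.ModEq.add_left_cancel' _ h1
    exact Fin.ext (Nat.ModEq.eq_of_lt_of_lt h3 i.2 j.2)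
  apply key
  rcases Nat.even_or_odd m with hm | hm
  · simp [s, hm.mul_right]
  · have hd : 2 ∣ m + 1 := (hm.add_one).two_dvd
    have h4 := congrArg (· % 2) h1
    simp only [Nat.mod_mod_of_dvd _ hd] at h4
    have h5 := hs i x
    have h6 := hs j x
    have h7 : i.val % 2 = j.val % 2 := by omega
    have h8 : Even (m * i.val) ↔ Even (m * j.val) := by
      rw [Nat.even_mul, Nat.even_mul, Nat.even_iff (n := i.val), Nat.even_iff (n := j.val), h7]
    simp only [s, h8]

variable {k : Type*} [Field k] {n : ℕ} {H : Subgroup (alternatingGroup (Fin n))}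

theorem mem_iff_of_inv {X : Type*} {G : Type*} [Group G] [MulAction G X] {H : Subgroup G} {O : Finset X}
    (hO : ∀ h ∈ H, ∀ x ∈ O, h • x ∈ O) (h : G) (hh : h ∈ H) (x : X) : h • x ∈ O ↔ x ∈ O := by
  refine ⟨fun hx => ?_, hO h hh x⟩
  simpa using hO h⁻¹ (H.inv_mem hh) _ hx

theorem LP.inv_trivial (h : LP k H) (hn : 3 ≤ n) (hn0 : (n : k) ≠ 0) (O : Finset (Fin n))
    (hO : ∀ h ∈ H, ∀ x ∈ O, h • x ∈ O) : O = ∅ ∨ O = Finset.univ := by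
  classical
  obtain ⟨g, hg⟩ := exists_sharp n hn
  let F : Fin n → k := fun x => if x ∈ O then (Oᶜ.card : k) else - (O.card : k)
  have hsum : ∑ x, F x = 0 := by
    simp only [F, Finset.sum_ite, Finset.sum_const]
    simp [← Finset.compl_filter]
    ring
  have hF := h.test F (fun h hh x => by simp only [F, mem_iff_of_inv hO h hh]) g 0
    (fun x => by rw [(hg x).sum_comp F, hsum, zero_mul]) (by simpa using hn0)
  by_contra! hcon
  obtain ⟨h1, h2⟩ := hcon
  obtain ⟨x, hx⟩ := h1
  obtain ⟨y, hy⟩ : ∃ y, y ∉ O := by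
    by_contra! h3
    exact h2 (Finset.eq_univ_iff_forall.2 h3)
  have e1 := congrFun hF x
  have e2 := congrFun hF y
  simp only [F, hx, hy, if_true, if_false, Pi.zero_apply, neg_eq_zero] at e1 e2
  have e3 := Finset.card_add_card_compl O
  rw [Fintype.card_fin] at e3
  apply hn0
  rw [← e3]
  push_cast
  rw [e1, e2, add_zero]

/-- The orbit of a point. -/
noncomputable def orb (H : Subgroup (alternatingGroup (Fin n))) (a : Fin n) : Finset (Fin n) :=
  open Classical in Finset.univ.filter (fun x => ∃ h ∈ H, h • a = x)

theorem mem_orb {a x : Fin n} : x ∈ orb H a ↔ ∃ h ∈ H, h • a = x := by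
  simp [orb]

theorem self_mem_orb (a : Fin n) : a ∈ orb H a := mem_orb.2 ⟨1, H.one_mem, one_smul _ _⟩

theorem orb_inv (a : Fin n) : ∀ h ∈ H, ∀ x ∈ orb H a, h • x ∈ orb H a := by
  intro h hh x hx
  obtain ⟨g, hg, rfl⟩ := mem_orb.1 hx
  exact mem_orb.2 ⟨h * g, H.mul_mem hh hg, mul_smul _ _ _⟩

theorem card_orb_dvd (a : Fin n) : (orb H a).card ∣ Nat.card H := by
  classical
  have h1 : (MulAction.orbit H a) = (orb H a : Set (Fin n)) := by
    ext x
    simp only [MulAction.mem_orbit_iff, Finset.mem_coe, mem_orb]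
    constructor
    · rintro ⟨h, rfl⟩
      exact ⟨h.1, h.2, rfl⟩
    · rintro ⟨h, hh, rfl⟩
      exact ⟨⟨h, hh⟩, rfl⟩
  have h2 := MulAction.index_stabilizer H a
  rw [h1, Set.ncard_coe_finset] at h2
  rw [← h2]
  exact Subgroup.index_dvd_card _

theorem LP.transitive (h : LP k H) (hn : 3 ≤ n) (hn0 : (n : k) ≠ 0) (a b : Fin n) :
    ∃ h : alternatingGroup (Fin n), h ∈ H ∧ (h : Perm (Fin n)) a = b := by
  rcases h.inv_trivial hn hn0 (orb H a) (orb_inv a) with h1 | h1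
  · have := self_mem_orb (H := H) a
    rw [h1] at this
    simp at this
  · have : b ∈ orb H a := by rw [h1]; simp
    exact mem_orb.1 this

end Trans
end IpAux

namespace IpAux
open MonoidAlgebra Equiv

section LemmaB

theorem sum_offdiag {n : ℕ} {k : Type*} [Field k] (φ : Fin n × Fin n → k) :
    ∑ e : {e : Fin n × Fin n // e.1 ≠ e.2}, φ e = (∑ i, ∑ j, φ (i, j)) - ∑ i, φ (i, i) := by
  classical
  rw [← Finset.sum_subtype (Finset.univ.filter (fun e : Fin n × Fin n => e.1 ≠ e.2)) (by simp) φ,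
    Finset.sum_filter, Fintype.sum_prod_type, ← Finset.sum_sub_distrib]
  refine Finset.sum_congr rfl fun i _ => ?_
  have : ∀ j, (if i ≠ j then φ (i, j) else 0) = φ (i, j) - if j = i then φ (i, i) else 0 := by
    intro j
    by_cases h : i = j
    · subst h; simp
    · simp [h, Ne.symm h]
  simp only [this, Finset.sum_sub_distrib]
  simp

variable {k : Type*} [Field k] {n : ℕ} {H : Subgroup (alternatingGroup (Fin n))}

theorem swap_row_sum (F : Fin n × Fin n → k) (hsym : ∀ x y, F (x, y) = F (y, x))
    (hdiag : ∀ x, F (x, x) = 0) (hrow : ∀ x, ∑ y, F (x, y) = 0) (x y : Fin n) (hxy : x ≠ y) (i : Fin n) :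
    ∑ j, F (swap i j x, swap i j y) = (n - 2 : k) * F (x, y) + F (i, y) + F (x, i)
      - (if i = x then (n - 2 : k) * F (x, y) else 0) - (if i = y then (n - 2 : k) * F (x, y) else 0) := by
  classical
  have hcol : ∀ y, ∑ x, F (x, y) = 0 := fun y => by rw [← hrow y]; simp_rw [hsym y]
  by_cases hix : i = x
  · subst hix
    have : ∀ j, F (swap i j i, swap i j y) = F (j, y) + if j = y then F (i, y) else 0 := by
      intro j
      rw [swap_apply_left]
      split_ifs with h
      · subst h; rw [swap_apply_right, hdiag, zero_add, hsym]
      · rw [swap_apply_of_ne_of_ne hxy.symm (Ne.symm h), add_zero]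
    simp_rw [this]
    rw [Finset.sum_add_distrib, hcol]
    simp [hxy, hdiag]
  by_cases hiy : i = y
  · subst hiy
    have : ∀ j, F (swap i j x, swap i j i) = F (x, j) + if j = x then F (x, i) else 0 := by
      intro j
      rw [swap_apply_left]
      split_ifs with h
      · subst h; rw [swap_apply_right, hdiag, zero_add, hsym]
      · rw [swap_apply_of_ne_of_ne hxy (Ne.symm h), add_zero]
    simp_rw [this]
    rw [Finset.sum_add_distrib, hrow]
    simp [hxy.symm, hdiag]
  · have : ∀ j, F (swap i j x, swap i j y) = F (x, y) + (if j = x then F (i, y) - F (x, y) else 0)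
        + (if j = y then F (x, i) - F (x, y) else 0) := by
      intro j
      by_cases h1 : j = x
      · subst h1
        rw [swap_apply_right, swap_apply_of_ne_of_ne (Ne.symm hiy) hxy.symm, if_pos rfl, if_neg hxy]
        ring
      by_cases h2 : j = y
      · subst h2
        rw [swap_apply_right, swap_apply_of_ne_of_ne (Ne.symm hix) hxy, if_pos rfl, if_neg h1]
        ring
      · rw [swap_apply_of_ne_of_ne (Ne.symm hix) (Ne.symm h1),
          swap_apply_of_ne_of_ne (Ne.symm hiy) (Ne.symm h2), if_neg h1, if_neg h2]
        ring
    simp_rw [this]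
    rw [Finset.sum_add_distrib, Finset.sum_add_distrib]
    simp [hix, hiy]
    ring

theorem swap_sum (F : Fin n × Fin n → k) (hsym : ∀ x y, F (x, y) = F (y, x))
    (hdiag : ∀ x, F (x, x) = 0) (hrow : ∀ x, ∑ y, F (x, y) = 0) (x : Fin n × Fin n) :
    ∑ e : {e : Fin n × Fin n // e.1 ≠ e.2}, F (swap e.1.1 e.1.2 • x) = ((n - 2 : k) ^ 2 - n) * F x := by
  obtain ⟨x, y⟩ := x
  have hcol : ∀ y, ∑ x, F (x, y) = 0 := fun y => by rw [← hrow y]; simp_rw [hsym y]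
  rw [sum_offdiag (fun e => F (swap e.1 e.2 • (x, y)))]
  change (∑ i, ∑ j, F (swap i j x, swap i j y)) - ∑ i, F (swap i i x, swap i i y) = _
  by_cases hxy : x = y
  · subst hxy
    simp [hdiag]
  simp_rw [swap_row_sum F hsym hdiag hrow x y hxy]
  simp only [Finset.sum_sub_distrib, Finset.sum_add_distrib, hrow, hcol]
  simp
  ring

theorem LP.lemmaB (h : LP k H) (hn0 : (n : k) = 0) (h2 : (2 : k) ≠ 0)
    (F : Fin n × Fin n → k) (hF : ∀ g ∈ H, ∀ x y, F (g • x, g • y) = F (x, y))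
    (hsym : ∀ x y, F (x, y) = F (y, x))
    (hdiag : ∀ x, F (x, x) = 0) (hrow : ∀ x, ∑ y, F (x, y) = 0) : ∀ x y, F (x, y) = 0 := by
  let J := {e : Fin n × Fin n // e.1 ≠ e.2}
  let g : J × J → alternatingGroup (Fin n) := fun e =>
    ⟨swap e.1.1.1 e.1.1.2 * swap e.2.1.1 e.2.1.2, by
      rw [Perm.mem_alternatingGroup, map_mul, Perm.sign_swap e.1.2, Perm.sign_swap e.2.2]; simp⟩
  have hcard : (Fintype.card J : k) = 0 := by
    have := sum_offdiag (k := k) (n := n) (fun _ => 1)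
    simp only [Finset.sum_const, Finset.card_univ, nsmul_eq_mul, mul_one, Fintype.card_fin, hn0,
      mul_zero, sub_zero] at this
    exact this
  have := h.test F (fun g hg x => hF g hg x.1 x.2) g (((n - 2 : k) ^ 2 - n) ^ 2) (fun x => by
    have e1 : ∀ e : J × J, F (g e • x) = F (swap e.1.1.1 e.1.1.2 • (swap e.2.1.1 e.2.1.2 • x)) :=
      fun e => rfl
    simp_rw [e1]
    rw [Fintype.sum_prod_type_right]
    simp only [swap_sum F hsym hdiag hrow, J]
    rw [← Finset.mul_sum, swap_sum F hsym hdiag hrow]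
    ring) (by
    rw [Fintype.card_prod, Nat.cast_mul, hcard, hn0, zero_mul]
    have : (((0 : k) - 2) ^ 2 - 0) ^ 2 = 2 ^ 4 := by ring
    rw [this]
    exact (pow_ne_zero _ h2).symm)
  intro x y
  rw [this]; rfl

/-- For `p` odd dividing `n`, invariant sets are trivial up to one point. -/
theorem LP.inv_small (h : LP k H) (hn0 : (n : k) = 0) (h2 : (2 : k) ≠ 0)
    (O : Finset (Fin n)) (hO : ∀ h ∈ H, ∀ x ∈ O, h • x ∈ O) : O.card ≤ 1 ∨ Oᶜ.card ≤ 1 := by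
  classical
  by_contra! hcon
  obtain ⟨hO1, hO2⟩ := hcon
  let a : k := O.card
  let b : k := Oᶜ.card
  have hab : a + b = 0 := by
    have e3 := Finset.card_add_card_compl O
    rw [Fintype.card_fin] at e3
    rw [← hn0, ← e3]
    push_cast
    rfl
  let F : Fin n × Fin n → k := fun e => if e.1 = e.2 then 0 else
    if e.1 ∈ O then (if e.2 ∈ O then - b * (b - 1) else (a - 1) * (b - 1))
    else (if e.2 ∈ O then (a - 1) * (b - 1) else - a * (a - 1))
  have hF := h.lemmaB hn0 h2 F (fun g hg x y => by
      simp only [F, mem_iff_of_inv hO g hg, smul_left_cancel_iff])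
    (fun x y => by
      simp only [F, eq_comm (a := x) (b := y)]
      split_ifs <;> rfl)
    (fun x => by simp [F])
    (fun x => by
      have hsplit : ∀ y, F (x, y) = (if y ∈ O then (if x ∈ O then - b * (b - 1) else (a - 1) * (b - 1))
          else (if x ∈ O then (a - 1) * (b - 1) else - a * (a - 1)))
          - (if y = x then (if x ∈ O then - b * (b - 1) else - a * (a - 1)) else 0) := by
        intro y
        simp only [F]
        by_cases hy : y = x
        · subst hy; split_ifs <;> simp_all
        · rw [if_neg (Ne.symm hy), if_neg hy]; split_ifs <;> simp
      simp_rw [hsplit]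
      rw [Finset.sum_sub_distrib, Finset.sum_ite, Finset.sum_const, Finset.sum_const]
      have e1 : (Finset.univ.filter (fun y => y ∈ O)) = O := by ext; simp
      have e2 : (Finset.univ.filter (fun y => y ∉ O)) = Oᶜ := by ext; simp
      rw [e1, e2, Finset.sum_ite_eq' , if_pos (Finset.mem_univ _), nsmul_eq_mul, nsmul_eq_mul]
      change a * _ + b * _ - _ = 0
      split_ifs <;> ring)
  obtain ⟨x, hx, y, hy, hxy⟩ := Finset.one_lt_card.1 hO1
  obtain ⟨u, hu, v, hv, huv⟩ := Finset.one_lt_card.1 hO2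
  rw [Finset.mem_compl] at hu hv
  have e1 := hF x y
  have e2 := hF u v
  have e3 := hF x u
  have hxu : x ≠ u := fun h => hu (h ▸ hx)
  simp only [F, hx, hy, hu, hv, hxy, huv, hxu, if_true, if_false] at e1 e2 e3
  have hb : b = - a := by linear_combination hab
  rw [hb] at e1 e3
  have h4 : (2 : k) * a = 0 := by linear_combination e2 - e1
  have h5 : a = 0 := by simpa [h2] using h4
  rw [h5] at e3
  norm_num at e3

end LemmaB
end IpAux

namespace IpAux
open MonoidAlgebra Equiv

section Transfer

/-- The embedding of a product of alternating groups. -/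
def jj {a b n : ℕ} (e : Fin a ⊕ Fin b ≃ Fin n) :
    alternatingGroup (Fin a) × alternatingGroup (Fin b) →* alternatingGroup (Fin n) where
  toFun g := ⟨e.permCongr (Equiv.sumCongr (g.1 : Perm (Fin a)) (g.2 : Perm (Fin b))), by
    rw [Perm.mem_alternatingGroup, Perm.sign_permCongr]
    have h1 := Perm.mem_alternatingGroup.1 g.1.2
    have h2 := Perm.mem_alternatingGroup.1 g.2.2
    have h3 := Perm.sign_sumCongr (g.1 : Perm (Fin a)) (g.2 : Perm (Fin b))
    rw [h1, h2, mul_one] at h3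
    exact h3⟩
  map_one' := by
    ext x
    obtain ⟨y, rfl⟩ := e.surjective x
    simp
  map_mul' := by
    intro g h
    apply Subtype.ext
    ext x
    obtain ⟨y, rfl⟩ := e.surjective x
    rcases y with y | y <;> simp

variable {a b n : ℕ} (e : Fin a ⊕ Fin b ≃ Fin n)

theorem jj_inl (g : alternatingGroup (Fin a) × alternatingGroup (Fin b)) (x : Fin a) :
    (jj e g : Perm (Fin n)) (e (Sum.inl x)) = e (Sum.inl ((g.1 : Perm (Fin a)) x)) := by
  simp [jj]

theorem jj_inr (g : alternatingGroup (Fin a) × alternatingGroup (Fin b)) (x : Fin b) :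
    (jj e g : Perm (Fin n)) (e (Sum.inr x)) = e (Sum.inr ((g.2 : Perm (Fin b)) x)) := by
  simp [jj]

theorem jj_inj : Function.Injective (jj e) := by
  rw [injective_iff_map_eq_one]
  intro g hg
  apply Prod.ext
  · apply Subtype.ext
    refine Equiv.ext fun x => ?_
    have := jj_inl e g x
    rw [hg] at this
    simpa using this.symm
  · apply Subtype.ext
    refine Equiv.ext fun x => ?_
    have := jj_inr e g x
    rw [hg] at this
    simpa using this.symm

theorem mem_range_jj (h : alternatingGroup (Fin n))
    (hmap : ∀ x, ∃ y, (h : Perm (Fin n)) (e (Sum.inl x)) = e (Sum.inl y))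
    (hodd : b = 1 ∨ Odd (orderOf h)) : h ∈ (jj e).range := by
  have h1 := Perm.mem_sumCongrHom_range_of_perm_mapsTo_inl
    (σ := e.symm.permCongr (h : Perm (Fin n))) (by
      rintro _ ⟨x, rfl⟩
      obtain ⟨y, hy⟩ := hmap x
      exact ⟨y, by simp [hy]⟩)
  obtain ⟨⟨σ, τ⟩, hst⟩ := h1
  have hst' : (h : Perm (Fin n)) = e.permCongr (Equiv.sumCongr σ τ) := by
    have : e.permCongr (e.symm.permCongr (h : Perm (Fin n))) = h := by ext; simp
    rw [← this, ← hst]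
    rfl
  have hsign : Perm.sign σ * Perm.sign τ = 1 := by
    have h2 := Perm.mem_alternatingGroup.1 h.2
    rw [hst', Perm.sign_permCongr] at h2
    rw [← h2]
    exact (Perm.sign_sumCongr σ τ).symm
  have hτ : Perm.sign τ = 1 := by
    rcases hodd with rfl | hodd
    · rw [Subsingleton.elim τ 1, map_one]
    · have h3 : ∀ (m : ℕ) (x : Fin b), ((h : Perm (Fin n)) ^ m) (e (Sum.inr x)) = e (Sum.inr ((τ ^ m) x)) := by
        intro m
        induction m with
        | zero => intro x; simp
        | succ m ih =>
          intro x
          rw [pow_succ, Perm.mul_apply, pow_succ, Perm.mul_apply, ← ih]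
          congr 1
          rw [hst']
          simp
      have h4 : τ ^ (orderOf h) = 1 := by
        refine Equiv.ext fun x => ?_
        have h5 := h3 (orderOf h) x
        have h6 : (h : Perm (Fin n)) ^ (orderOf h) = 1 := by
          rw [← Subgroup.coe_pow, pow_orderOf_eq_one, Subgroup.coe_one]
        rw [h6] at h5
        simpa using h5.symm
      have h5 : Perm.sign τ ^ (orderOf h) = 1 := by rw [← map_pow, h4, map_one]
      rcases Int.units_eq_one_or (Perm.sign τ) with h6 | h6
      · exact h6
      · rw [h6, hodd.neg_one_pow] at h5
        exact absurd h5 (by decide)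
  have hσ : Perm.sign σ = 1 := by rwa [hτ, mul_one] at hsign
  refine ⟨(⟨σ, Perm.mem_alternatingGroup.2 hσ⟩, ⟨τ, Perm.mem_alternatingGroup.2 hτ⟩), ?_⟩
  apply Subtype.ext
  rw [hst']
  rfl

variable {k : Type*} [Field k] {H : Subgroup (alternatingGroup (Fin n))}

theorem LP.transfer (h : LP k H) (hr : H ≤ (jj e).range) :
    ∃ (T : Subgroup (alternatingGroup (Fin a))) (U : Subgroup (alternatingGroup (Fin b))),
      LP k T ∧ LP k U ∧ H ≤ (T.prod U).map (jj e) ∧ Nat.card T ≤ Nat.card H := by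
  have hH : (H.comap (jj e)).map (jj e) = H := Subgroup.map_comap_eq_self hr
  have h1 : LP k (H.comap (jj e)) := LP.comap_inj (jj e) (jj_inj e) _ (by rw [hH]; exact h)
  refine ⟨(H.comap (jj e)).map (MonoidHom.fst _ _), (H.comap (jj e)).map (MonoidHom.snd _ _),
    h1.map_surj _ Prod.fst_surjective, h1.map_surj _ Prod.snd_surjective, ?_, ?_⟩
  · conv_lhs => rw [← hH]
    apply Subgroup.map_mono
    rw [Subgroup.le_prod_iff]
    exact ⟨le_rfl, le_rfl⟩
  · refine (Nat.le_of_dvd Nat.card_pos (Subgroup.card_map_dvd _ _)).trans ?_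
    conv_rhs => rw [← hH]
    exact (Subgroup.card_map_of_injective (jj_inj e)).ge

theorem card_prod_map (T : Subgroup (alternatingGroup (Fin a))) (U : Subgroup (alternatingGroup (Fin b))) :
    Nat.card ((T.prod U).map (jj e)) = Nat.card T * Nat.card U := by
  rw [Subgroup.card_map_of_injective (jj_inj e), Nat.card_congr (T.prodEquiv U).toEquiv, Nat.card_prod]

/-- an equivalence adapted to a subset -/
theorem exists_split (O : Finset (Fin n)) : ∃ e : Fin O.card ⊕ Fin Oᶜ.card ≃ Fin n,
    (∀ x, e (Sum.inl x) ∈ O) ∧ (∀ y, e (Sum.inr y) ∉ O) := by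
  refine ⟨finSumEquivOfFinset rfl rfl, fun x => ?_, fun y => ?_⟩
  · rw [finSumEquivOfFinset_inl]
    exact Finset.orderEmbOfFin_mem _ _ _
  · rw [finSumEquivOfFinset_inr, ← Finset.mem_compl]
    exact Finset.orderEmbOfFin_mem _ _ _

theorem LP.split (h : LP k H) (O : Finset (Fin n)) (hO : ∀ h ∈ H, ∀ x ∈ O, h • x ∈ O)
    (ha : O.card = a) (hb : Oᶜ.card = b)
    (hodd : b = 1 ∨ Odd (Nat.card H)) :
    ∃ (e : Fin a ⊕ Fin b ≃ Fin n) (T : Subgroup (alternatingGroup (Fin a)))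
      (U : Subgroup (alternatingGroup (Fin b))),
      LP k T ∧ LP k U ∧ H ≤ (T.prod U).map (jj e) ∧ Nat.card T ≤ Nat.card H := by
  subst ha hb
  obtain ⟨e, h1, h2⟩ := exists_split O
  refine ⟨e, h.transfer e ?_⟩
  intro g hg
  apply mem_range_jj
  · intro x
    obtain ⟨y | y, hy⟩ := e.surjective ((g : Perm (Fin n)) (e (Sum.inl x)))
    · exact ⟨y, hy.symm⟩
    · exfalso
      apply h2 y
      rw [hy]
      exact hO g hg _ (h1 x)
  · refine hodd.imp_right fun h3 => ?_
    have h4 : orderOf g ∣ Nat.card H := by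
      have := orderOf_dvd_natCard (⟨g, hg⟩ : H)
      rwa [← Subgroup.orderOf_coe] at this
    exact Odd.of_dvd_nat h3 h4

end Transfer
end IpAux

namespace IpAux
open MonoidAlgebra Equiv

section OddCase

variable {k : Type*} [Field k] {n : ℕ} {H : Subgroup (alternatingGroup (Fin n))}

/-- The dihedral configuration on six points is impossible. -/
theorem LP.not_ten (h : LP k H) (hn0 : (n : k) = 0) (h2 : (2 : k) ≠ 0) (hcard : Nat.card H = 10) : False := by
  classical
  have : Fact (Nat.Prime 5) := ⟨by norm_num⟩
  obtain ⟨c, hc⟩ := exists_prime_orderOf_dvd_card' (G := H) 5 (by rw [hcard]; norm_num)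
  have hidx : (Subgroup.zpowers c).index = 2 := by
    have := (Subgroup.zpowers c).card_mul_index
    rw [Nat.card_zpowers, hc, hcard] at this
    omega
  have hnorm : (Subgroup.zpowers c).Normal := Subgroup.normal_of_index_eq_two hidx
  have c5 : c ^ 5 = 1 := by rw [← hc]; exact pow_orderOf_eq_one c
  have hconj : ∀ g : H, g * c * g⁻¹ = c ∨ g * c * g⁻¹ = c⁻¹ := by
    intro g
    have h1 := hnorm.conj_mem c (Subgroup.mem_zpowers c) g
    have h3 := Subgroup.mul_self_mem_of_index_two hidx g
    have h4 : (g * g) * c * (g * g)⁻¹ = c := by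
      obtain ⟨i, hi⟩ := Subgroup.mem_zpowers_iff.1 h3
      rw [← hi]
      group
    rw [mem_zpowers_iff_mem_range_orderOf, hc] at h1
    obtain ⟨i, hi, hic⟩ := Finset.mem_image.1 h1
    rw [Finset.mem_range] at hi
    have h5 : g * (g * c * g⁻¹) * g⁻¹ = c :=
      calc g * (g * c * g⁻¹) * g⁻¹ = (g * g) * c * (g * g)⁻¹ := by group
        _ = c := h4
    have h6 : g * c ^ i * g⁻¹ = c ^ (i * i) := by
      rw [← conj_pow, ← hic, pow_mul]
    rw [← hic, h6] at h5
    have h7 : c ^ (i * i) = c ^ 1 := by rw [h5, pow_one]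
    rw [pow_inj_mod, hc] at h7
    interval_cases i
    · simp at h7
    · left; rw [← hic, pow_one]
    · simp at h7
    · simp at h7
    · right
      rw [← hic, eq_inv_iff_mul_eq_one, ← pow_succ, c5]
  let d : Perm (Fin n) := ((c : alternatingGroup (Fin n)) : Perm (Fin n))
  have hd5 : d ^ 5 = 1 := by
    have := congrArg (fun x : H => ((x : alternatingGroup (Fin n)) : Perm (Fin n))) c5
    exact this
  have d5 : ∀ x, d (d (d (d (d x)))) = x := fun x => by
    have := congrArg (fun e : Perm (Fin n) => e x) hd5
    exact this
  have dd : ∀ x, d (d x) = x ↔ d x = x := fun x => by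
    constructor
    · intro h1
      have := d5 x
      rwa [h1, h1] at this
    · intro h1
      rw [h1, h1]
  let F : Fin n × Fin n → k := fun e =>
    (if e.2 = d e.1 then 1 else 0) + (if d e.2 = e.1 then 1 else 0)
      - (if e.2 = d (d e.1) then 1 else 0) - (if d (d e.2) = e.1 then 1 else 0)
  have hF := h.lemmaB hn0 h2 F (fun g hg x y => by
      have e1 : (g : Perm (Fin n)) * d * (g : Perm (Fin n))⁻¹ = d ∨
          (g : Perm (Fin n)) * d * (g : Perm (Fin n))⁻¹ = d⁻¹ := by
        rcases hconj ⟨g, hg⟩ with h1 | h1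
        · left
          exact congrArg (fun x : H => ((x : alternatingGroup (Fin n)) : Perm (Fin n))) h1
        · right
          exact congrArg (fun x : H => ((x : alternatingGroup (Fin n)) : Perm (Fin n))) h1
      change F ((g : Perm (Fin n)) x, (g : Perm (Fin n)) y) = _
      generalize (g : Perm (Fin n)) = g' at e1
      rcases e1 with e1 | e1
      · have e2 : ∀ z, d (g' z) = g' (d z) := fun z => by
          have := congrArg (fun e : Perm (Fin n) => e (g' z)) e1
          simpa using this.symm
        simp only [F, e2, g'.injective.eq_iff]
      · have e2 : ∀ z, d (g' (d z)) = g' z := fun z => by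
          have := congrArg (fun e : Perm (Fin n) => d (e (g' z))) e1
          simpa using this
        have e3 : ∀ u v, g' u = d (g' v) ↔ d u = v := fun u v => by
          rw [← e2 u, d.injective.eq_iff, g'.injective.eq_iff]
        have e4 : ∀ u v, g' u = d (d (g' v)) ↔ d (d u) = v := fun u v => by
          rw [← e2 u, d.injective.eq_iff, e3]
        simp only [F, e3, e4, eq_comm (a := d (g' y)), eq_comm (a := d (d (g' y)))]
        simp only [eq_comm (a := d x), eq_comm (a := d (d x))]
        ring)
    (fun x y => by
      simp only [F, eq_comm (a := y) (b := d x), eq_comm (a := y) (b := d (d x)),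
        eq_comm (a := x) (b := d y), eq_comm (a := x) (b := d (d y))]
      ring)
    (fun x => by
      simp only [F, eq_comm (a := x) (b := d x), eq_comm (a := x) (b := d (d x)), dd]
      ring)
    (fun x => by
      have e1 : ∀ y, (d y = x) ↔ y = d.symm x := fun y => by rw [Equiv.eq_symm_apply]
      have e2 : ∀ y, (d (d y) = x) ↔ y = d.symm (d.symm x) := fun y => by
        rw [Equiv.eq_symm_apply, Equiv.eq_symm_apply]
      simp only [F, e2]
      simp only [e1, Finset.sum_sub_distrib, Finset.sum_add_distrib]
      simp)
  obtain ⟨x, hx⟩ : ∃ x, d x ≠ x := by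
    by_contra! hcon
    have : c = 1 := by
      apply Subtype.ext
      apply Subtype.ext
      exact Equiv.ext hcon
    rw [this] at hc
    simp at hc
  have h1 := hF x (d x)
  have n1 : d (d x) ≠ x := fun h => hx ((dd x).1 h)
  have n2 : d x ≠ d (d x) := fun h => hx (d.injective h).symm
  have n3 : d (d (d x)) ≠ x := fun h => by
    have := d5 x
    rw [h] at this
    exact n1 this
  simp [F, n1, n2, n3] at h1

theorem not_dvd_card_alt {p : ℕ} (hp : p.Prime) (h2 : 2 < p) :
    ¬ p ∣ Nat.card (alternatingGroup (Fin (p - 1))) := by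
  intro h
  have h1 : Nat.card (alternatingGroup (Fin (p - 1))) ∣ (p - 1).factorial := by
    have := Subgroup.card_subgroup_dvd_card (alternatingGroup (Fin (p - 1)))
    rwa [Nat.card_perm, Nat.card_fin] at this
  have := (hp.dvd_factorial).1 (h.trans h1)
  omega

theorem LP.stab {p : ℕ} (hp : p.Prime) [CharP k p] (h2 : 2 < p) (hnp : n = p) (h5 : 5 ≤ n) (h : LP k H) (z : Fin n)
    (hz : ∀ h ∈ H, h • z = z) : AltTable n p H := by
  left
  have hc1 : ({z} : Finset (Fin n)).card = 1 := by simp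
  have hc2 : ({z} : Finset (Fin n))ᶜ.card = n - 1 := by simp [Finset.card_compl]
  obtain ⟨e, he1, he2⟩ := exists_split ({z} : Finset (Fin n))ᶜ
  have hc3 : ({z} : Finset (Fin n))ᶜᶜ.card = 1 := by simp
  generalize ({z} : Finset (Fin n))ᶜᶜ.card = b at *
  generalize hOO : ({z} : Finset (Fin n))ᶜ.card = a at *
  subst hc2 hc3
  have hez : ∀ y, e (Sum.inr y) = z := fun y => by simpa using he2 y
  have hst : MulAction.stabilizer (alternatingGroup (Fin n)) z = (jj e).range := by
    apply le_antisymm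
    · intro g hg
      apply mem_range_jj e g _ (Or.inl rfl)
      intro x
      obtain ⟨y | y, hy⟩ := e.surjective ((g : Perm (Fin n)) (e (Sum.inl x)))
      · exact ⟨y, hy.symm⟩
      · exfalso
        have h1 : (g : Perm (Fin n)) z = z := hg
        rw [hez, ← h1] at hy
        have := (g : Perm (Fin n)).injective hy
        have h3 := he1 x
        simp [← this] at h3
    · rintro _ ⟨g, rfl⟩
      change (jj e g : Perm (Fin n)) z = z
      rw [← hez 0, jj_inr, hez, hez]
  have hequiv : (MulAction.stabilizer (alternatingGroup (Fin n)) z) ≃* alternatingGroup (Fin (n - 1)) :=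
    (MulEquiv.subgroupCongr hst).trans
      ((MonoidHom.ofInjective (jj_inj e)).symm.trans MulEquiv.prodUnique)
  have hle : H ≤ MulAction.stabilizer (alternatingGroup (Fin n)) z := fun g hg => hz g hg
  have hcard := h.card_le (MulAction.stabilizer (alternatingGroup (Fin n)) z) (by
    rw [Ne, CharP.cast_eq_zero_iff k p, Nat.card_congr hequiv.toEquiv]
    subst hnp
    exact not_dvd_card_alt hp h2)
  have hH : H = MulAction.stabilizer (alternatingGroup (Fin n)) z :=
    Subgroup.eq_of_le_of_card_ge hle hcard
  refine ⟨hnp, ⟨z, hH⟩, ?_, ?_⟩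
  · rw [hH]; exact ⟨hequiv⟩
  · rw [hH]
    obtain ⟨g, hg⟩ := exists_sharp n (by omega)
    have : MulAction.IsPretransitive (alternatingGroup (Fin n)) (Fin n) := 
      ⟨fun x y => by
        obtain ⟨i, hi⟩ := (hg x).2 y
        exact ⟨g i, hi⟩⟩
    rw [MulAction.index_stabilizer_of_transitive, Nat.card_fin]

end OddCase
end IpAux

namespace IpAux
open MonoidAlgebra Equiv

section BigSubgroups

theorem card_alt3 : Nat.card (alternatingGroup (Fin 3)) = 3 := by
  have := two_mul_nat_card_alternatingGroup (α := Fin 3)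
  rw [Nat.card_perm, Nat.card_fin] at this
  have h6 : Nat.factorial 3 = 6 := rfl
  rw [h6] at this
  omega

theorem card_alt1 : Nat.card (alternatingGroup (Fin 1)) = 1 := by
  rw [Nat.card_eq_one_iff_unique]
  exact ⟨inferInstance, inferInstance⟩

theorem exists_prod {a b : ℕ} (n : ℕ) (hn : a + b = n) (T : Subgroup (alternatingGroup (Fin a)))
    (U : Subgroup (alternatingGroup (Fin b))) :
    ∃ K : Subgroup (alternatingGroup (Fin n)), Nat.card K = Nat.card T * Nat.card U := by
  subst hn
  exact ⟨_, card_prod_map finSumFinEquiv T U⟩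

theorem exists_nine : ∃ K : Subgroup (alternatingGroup (Fin 6)), Nat.card K = 9 := by
  obtain ⟨K, hK⟩ := exists_prod (a := 3) (b := 3) 6 rfl ⊤ ⊤
  refine ⟨K, ?_⟩
  rw [hK, Subgroup.card_top, card_alt3]

theorem exists_27 : ∃ K : Subgroup (alternatingGroup (Fin 10)), Nat.card K = 27 := by
  obtain ⟨K, hK⟩ := exists_prod (a := 3) (b := 1) 4 rfl ⊤ ⊤
  obtain ⟨L, hL⟩ := exists_nine
  obtain ⟨M, hM⟩ := exists_prod (a := 6) (b := 4) 10 rfl L K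
  refine ⟨M, ?_⟩
  rw [hM, hK, hL, Subgroup.card_top, Subgroup.card_top, card_alt3, card_alt1]

/-- The affine group of order 21. -/
def aff21 : Subgroup (Perm (ZMod 7)) where
  carrier := {g | ∃ a b : ZMod 7, a ^ 3 = 1 ∧ ∀ x, g x = a * x + b}
  one_mem' := ⟨1, 0, by simp, by simp⟩
  mul_mem' := by
    rintro g h ⟨a, b, ha, hg⟩ ⟨c, d, hc, hh⟩
    refine ⟨a * c, a * d + b, by rw [mul_pow, ha, hc, mul_one], fun x => ?_⟩
    rw [Perm.mul_apply, hg, hh]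
    ring
  inv_mem' := by
    rintro g ⟨a, b, ha, hg⟩
    refine ⟨a ^ 2, - a ^ 2 * b, by rw [← pow_mul, mul_comm, pow_mul, ha, one_pow], fun x => ?_⟩
    rw [Perm.inv_eq_iff_eq, hg]
    linear_combination (b - x) * ha

theorem card_aff21 : Nat.card aff21 = 21 := by
  have key : ∀ a : {a : ZMod 7 // a ^ 3 = 1}, ∀ b : ZMod 7, Function.Bijective fun x => a.1 * x + b := by
    decide
  let f : {a : ZMod 7 // a ^ 3 = 1} × ZMod 7 → aff21 := fun e =>
    ⟨Equiv.ofBijective _ (key e.1 e.2), e.1.1, e.2, e.1.2, fun x => rfl⟩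
  have hf : Function.Bijective f := by
    constructor
    · rintro ⟨⟨a, ha⟩, b⟩ ⟨⟨c, hc⟩, d⟩ h
      have h1 : ∀ x, a * x + b = c * x + d := fun x =>
        congrArg (fun g : aff21 => (g : Perm (ZMod 7)) x) h
      have h2 := h1 0
      have h3 := h1 1
      simp only [mul_zero, zero_add, mul_one] at h2 h3
      subst h2
      have h4 := add_right_cancel h3
      subst h4
      rfl
    · rintro ⟨g, a, b, ha, hg⟩
      refine ⟨(⟨a, ha⟩, b), ?_⟩
      apply Subtype.ext
      exact Equiv.ext fun x => (hg x).symm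
  rw [← Nat.card_congr (Equiv.ofBijective f hf), Nat.card_eq_fintype_card]
  decide

theorem exists_21_aux (P : Subgroup (Perm (Fin 7))) (hP : Nat.card P = 21) :
    ∃ K : Subgroup (alternatingGroup (Fin 7)), Nat.card K = 21 := by
  have hle : P ≤ alternatingGroup (Fin 7) := by
    intro g hg
    rw [Perm.mem_alternatingGroup]
    have h1 : g ^ 21 = 1 := by
      have := pow_card_eq_one' (x := (⟨g, hg⟩ : P))
      rw [hP] at this
      exact congrArg Subtype.val this
    have h5 : Perm.sign g ^ 21 = 1 := by rw [← map_pow, h1, map_one]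
    rcases Int.units_eq_one_or (Perm.sign g) with h6 | h6
    · exact h6
    · rw [h6] at h5
      exact absurd h5 (by decide)
  exact ⟨P.subgroupOf _, by rw [Nat.card_congr (Subgroup.subgroupOfEquivOfLe hle).toEquiv, hP]⟩

theorem exists_21 : ∃ K : Subgroup (alternatingGroup (Fin 8)), Nat.card K = 21 := by
  obtain ⟨L, hL⟩ := exists_21_aux aff21 card_aff21
  obtain ⟨M, hM⟩ := exists_prod (a := 7) (b := 1) 8 rfl L ⊤
  refine ⟨M, ?_⟩
  rw [hM, hL, Subgroup.card_top, card_alt1]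

end BigSubgroups

section Final

theorem odd_case (k : Type) [Field k] (p : ℕ) [Fact p.Prime] [IsAlgClosed k] [CharP k p]
    (n : ℕ) (hn : 5 ≤ n) (hp : p ≤ n) (H : Subgroup ↥(alternatingGroup (Fin n)))
    (h : LP k H) (hnotable : ¬ AltTable n p H)
    (hmin : ∀ m, 5 ≤ m → m < n → p ≤ m →
          ∀ H' : Subgroup ↥(alternatingGroup (Fin m)), HasIp k p H' → AltTable m p H')
    (hdvd : p ∣ n) (hp2 : p ≠ 2) : False := by
  have hpp : p.Prime := Fact.out
  have hp3 : 2 < p := lt_of_le_of_ne hpp.two_le (Ne.symm hp2)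
  have hn0 : (n : k) = 0 := (CharP.cast_eq_zero_iff k p n).2 hdvd
  have h2 : (2 : k) ≠ 0 := by
    intro h0
    have : ((2 : ℕ) : k) = 0 := by exact_mod_cast h0
    rw [CharP.cast_eq_zero_iff k p] at this
    exact absurd (Nat.le_of_dvd (by norm_num) this) (by omega)
  have hpH : ¬ p ∣ Nat.card H := by rw [← CharP.cast_eq_zero_iff k p]; exact h.1
  obtain ⟨z, hz⟩ : ∃ z : Fin n, ∀ g ∈ H, g • z = z := by
    let z0 : Fin n := ⟨0, by omega⟩
    rcases h.inv_small hn0 h2 (orb H z0) (orb_inv z0) with h1 | h1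
    · refine ⟨z0, fun g hg => ?_⟩
      exact Finset.card_le_one.1 h1 _ (orb_inv z0 g hg _ (self_mem_orb z0)) _ (self_mem_orb z0)
    · have hc := Finset.card_add_card_compl (orb H z0)
      rw [Fintype.card_fin] at hc
      rcases Nat.le_one_iff_eq_zero_or_eq_one.1 h1 with h3 | h3
      · exfalso
        rw [h3, add_zero] at hc
        have := card_orb_dvd (H := H) z0
        rw [hc] at this
        exact hpH (hdvd.trans this)
      · obtain ⟨z, hz⟩ := Finset.card_eq_one.1 h3
        refine ⟨z, fun g hg => ?_⟩
        have e1 : z ∉ orb H z0 := by rw [← Finset.mem_compl, hz]; simp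
        have e2 : g • z ∉ orb H z0 := by rwa [mem_iff_of_inv (orb_inv z0) g hg]
        rw [← Finset.mem_compl, hz] at e2
        simpa using e2
  by_cases hnp : n = p
  · exact hnotable (h.stab hpp hp3 hnp hn z hz)
  have hlt : p < n := lt_of_le_of_ne hp (Ne.symm hnp)
  have h2p : 2 * p ≤ n := by
    obtain ⟨t, rfl⟩ := hdvd
    have : 2 ≤ t := by
      by_contra! hc
      interval_cases t <;> omega
    nlinarith
  obtain ⟨e, T, U, hT, hU, hle, hcT⟩ := h.split (a := n - 1) (b := 1) ({z}ᶜ)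
    (fun g hg x hx => by
      rw [Finset.mem_compl, Finset.mem_singleton] at hx ⊢
      intro h3
      apply hx
      rw [← hz g hg] at h3
      exact smul_left_cancel _ h3) (by simp [Finset.card_compl]) (by simp) (Or.inl rfl)
  have hc1 : Nat.card H ≤ Nat.card T * Nat.card U := by
    rw [← card_prod_map e]
    exact Subgroup.card_le_of_le hle
  have hc2 : Nat.card U ≤ 1 := by
    exact (Subgroup.card_le_card_group U).trans card_alt1.le
  have hc3 : Nat.card H = Nat.card T := by
    refine le_antisymm ?_ hcT
    nlinarith
  have htab := hmin (n - 1) (by omega) (by omega) (by omega) T (HasIp_of_LP hT)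
  obtain ⟨t, ht⟩ := hdvd
  rcases htab with h1 | h1 | h1 | h1 | h1 | h1 | h1
  · omega
  · exact hp2 h1.2.1
  · obtain ⟨-, -, ⟨E⟩, -⟩ := h1
    have : Nat.card T = 10 := by rw [Nat.card_congr E.toEquiv, DihedralGroup.nat_card]
    exact h.not_ten hn0 h2 (by rw [hc3, this])
  · exact hp2 h1.2.1
  · obtain ⟨h3, h4, -⟩ := h1
    subst h4
    omega
  · obtain ⟨h3, h4, -⟩ := h1
    subst h4
    omega
  · obtain ⟨h3, h4, -⟩ := h1
    subst h4
    omega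

theorem small_odd (k : Type) [Field k] [IsAlgClosed k] [CharP k 2] (m : ℕ)
    (T : Subgroup (alternatingGroup (Fin m))) (hT : LP k T) (hm : Odd m)
    (hmin : 5 ≤ m → ∀ H' : Subgroup ↥(alternatingGroup (Fin m)), HasIp k 2 H' → AltTable m 2 H') :
    (m = 1 ∧ Nat.card T ≤ 1) ∨ (m = 3 ∧ Nat.card T ≤ 3) ∨ (m = 5 ∧ Nat.card T ≤ 5) := by
  have : Fact (Nat.Prime 2) := ⟨Nat.prime_two⟩
  obtain ⟨r, hr⟩ := hm
  by_cases h5 : 5 ≤ m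
  · have htab := hmin h5 T (HasIp_of_LP hT)
    rcases htab with h1 | h1 | h1 | h1 | h1 | h1 | h1
    · omega
    · exact Or.inr (Or.inr ⟨h1.1, h1.2.2.2.1.le⟩)
    · have := h1.2.1; omega
    · have := h1.1; omega
    · have := h1.1; omega
    · have := h1.2.1; omega
    · have := h1.2.1; omega
  · have h6 : m = 1 ∨ m = 3 := by omega
    rcases h6 with rfl | rfl
    · left
      refine ⟨rfl, ?_⟩
      exact (Subgroup.card_le_card_group T).trans card_alt1.le
    · right; left
      refine ⟨rfl, ?_⟩
      exact (Subgroup.card_le_card_group T).trans card_alt3.le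

theorem nine_case (k : Type) [Field k] [CharP k 2] (H : Subgroup ↥(alternatingGroup (Fin 6)))
    (h : LP k H) (e : Fin 3 ⊕ Fin 3 ≃ Fin 6) (T U : Subgroup (alternatingGroup (Fin 3)))
    (hle : H ≤ (T.prod U).map (jj e)) (hT : Nat.card T ≤ 3) (hU : Nat.card U ≤ 3) :
    AltTable 6 2 H := by
  obtain ⟨K, hK⟩ := exists_nine
  have h9 := h.card_le K (by rw [hK, Ne, CharP.cast_eq_zero_iff k 2]; norm_num)
  rw [hK] at h9
  have hc1 : Nat.card H ≤ Nat.card T * Nat.card U := by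
    rw [← card_prod_map e]
    exact Subgroup.card_le_of_le hle
  have hT3 : Nat.card T = 3 := by nlinarith
  have hU3 : Nat.card U = 3 := by nlinarith
  have hc : Nat.card H = 9 := by
    rw [hT3, hU3] at hc1
    omega
  have hH : H = (T.prod U).map (jj e) :=
    Subgroup.eq_of_le_of_card_ge hle (by rw [card_prod_map, hT3, hU3, hc])
  right; right; right; left
  have : Fact (Nat.Prime 3) := ⟨by norm_num⟩
  have hz3 : Nat.card (Multiplicative (ZMod 3)) = 3 := by simp
  refine ⟨rfl, rfl, ⟨?_⟩, ?_⟩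
  · exact (MulEquiv.subgroupCongr hH).trans
      (((T.prod U).equivMapOfInjective (jj e) (jj_inj e)).symm.trans
        ((T.prodEquiv U).trans (MulEquiv.prodCongr (mulEquivOfPrimeCardEq hT3 hz3)
          (mulEquivOfPrimeCardEq hU3 hz3))))
  · have h1 := H.card_mul_index
    have h2 := two_mul_nat_card_alternatingGroup (α := Fin 6)
    rw [Nat.card_perm, Nat.card_fin] at h2
    have h6 : Nat.factorial 6 = 720 := rfl
    rw [h6] at h2
    rw [hc] at h1
    omega

theorem two_case (k : Type) [Field k] [IsAlgClosed k] [CharP k 2]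
    (n : ℕ) (hn : 5 ≤ n) (H : Subgroup ↥(alternatingGroup (Fin n)))
    (h : LP k H) (hnotable : ¬ AltTable n 2 H)
    (hmin : ∀ m, 5 ≤ m → m < n →
          ∀ H' : Subgroup ↥(alternatingGroup (Fin m)), HasIp k 2 H' → AltTable m 2 H')
    (hdvd : 2 ∣ n) : False := by
  have hpH : ¬ 2 ∣ Nat.card H := by rw [← CharP.cast_eq_zero_iff k 2]; exact h.1
  have hodd : Odd (Nat.card H) := by rwa [← Nat.not_even_iff_odd, even_iff_two_dvd]
  let z0 : Fin n := ⟨0, by omega⟩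
  have ha : Odd (orb H z0).card := Odd.of_dvd_nat hodd (card_orb_dvd z0)
  have hc := Finset.card_add_card_compl (orb H z0)
  rw [Fintype.card_fin] at hc
  have hb : Odd (orb H z0)ᶜ.card := by
    obtain ⟨r, hr⟩ := ha
    obtain ⟨s, hs⟩ := hdvd
    exact ⟨s - r - 1, by omega⟩
  obtain ⟨e, T, U, hT, hU, hle, -⟩ := h.split (orb H z0) (orb_inv z0) rfl rfl (Or.inr hodd)
  generalize (orb H z0).card = a at *
  generalize (orb H z0)ᶜ.card = b at *
  have hc1 : Nat.card H ≤ Nat.card T * Nat.card U := by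
    rw [← card_prod_map e]
    exact Subgroup.card_le_of_le hle
  have ha0 := ha.pos
  have hb0 := hb.pos
  have hTs := small_odd k a T hT ha (fun h5 => hmin a h5 (by omega))
  have hUs := small_odd k b U hU hb (fun h5 => hmin b h5 (by omega))
  have six : n = 6 → 9 ≤ Nat.card H := by
    rintro rfl
    obtain ⟨K, hK⟩ := exists_nine
    have h9 := h.card_le K (by rw [hK, Ne, CharP.cast_eq_zero_iff k 2]; norm_num)
    rwa [hK] at h9
  have eight : n = 8 → 21 ≤ Nat.card H := by
    rintro rfl
    obtain ⟨K, hK⟩ := exists_21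
    have h9 := h.card_le K (by rw [hK, Ne, CharP.cast_eq_zero_iff k 2]; norm_num)
    rwa [hK] at h9
  have ten : n = 10 → 27 ≤ Nat.card H := by
    rintro rfl
    obtain ⟨K, hK⟩ := exists_27
    have h9 := h.card_le K (by rw [hK, Ne, CharP.cast_eq_zero_iff k 2]; norm_num)
    rwa [hK] at h9
  rcases hTs with ⟨rfl, h1⟩ | ⟨rfl, h1⟩ | ⟨rfl, h1⟩ <;>
  rcases hUs with ⟨rfl, h2⟩ | ⟨rfl, h2⟩ | ⟨rfl, h2⟩ <;>
  have hmul := hc1.trans (Nat.mul_le_mul h1 h2)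
  · omega
  · omega
  · have := six (by omega); omega
  · omega
  · obtain rfl : n = 6 := by omega
    exact hnotable (nine_case k H h e T U hle h1 h2)
  · have := eight (by omega); omega
  · have := six (by omega); omega
  · have := eight (by omega); omega
  · have := ten (by omega); omega

end Final
end IpAux

/-- If `A_n` (`n ≥ 5` minimal) has property `(I_p)` with respect to `H` and `(A_n, H, p)` is
not in the classification table, then `H` is a transitive subgroup; in particular `p ∤ n`. -/
theorem stmt9 (k : Type) [Field k] (p : ℕ) [Fact p.Prime] [IsAlgClosed k] [CharP k p]
    (n : ℕ) (hn : 5 ≤ n) (hp : p ≤ n) (H : Subgroup ↥(alternatingGroup (Fin n)))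
    (hIp : HasIp k p H) (hnotable : ¬ AltTable n p H)
    (hmin : ∀ m, 5 ≤ m → m < n →
      ∀ (q : ℕ), q.Prime → q ≤ m →
        ∀ (k' : Type) [Field k'] [IsAlgClosed k'] [CharP k' q],
          ∀ H' : Subgroup ↥(alternatingGroup (Fin m)), HasIp k' q H' → AltTable m q H') :
    (∀ a b : Fin n, ∃ h : ↥(alternatingGroup (Fin n)),
      h ∈ H ∧ (h : Equiv.Perm (Fin n)) a = b) ∧ ¬ p ∣ n := by
  have h := IpAux.LP_of_HasIp hIp
  have hnd : ¬ p ∣ n := by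
    intro hdvd
    by_cases hp2 : p = 2
    · subst hp2
      exact IpAux.two_case k n hn H h hnotable
        (fun m h1 h2 H' hH' => hmin m h1 h2 2 Nat.prime_two (by omega) k H' hH') hdvd
    · exact IpAux.odd_case k p n hn hp H h hnotable
        (fun m h1 h2 h3 H' hH' => hmin m h1 h2 p Fact.out h3 k H' hH') hdvd hp2
  refine ⟨fun a b => ?_, hnd⟩
  exact h.transitive (by omega) (by rwa [Ne, CharP.cast_eq_zero_iff k p]) a b
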